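/- Let 𝕏 be a countable homogeneous relational structure, let f ∈ End(𝕏) be back and fo, and let g ∈ End(𝕏) be rth. Then for every h ∈ End(𝕏), the set S_{f,g,h} of all finite partial isomorphisms p of 𝕏 such that the composite x ↦ g(p(f(x))) (defined for those x with f(x) ∈ dom(p)) is a restriction of h, and such that the partial map (g∘p) ∪ (h∘f⁻¹) (sending y ∈ dom(p) to g(p(y)) and y = f(x) ∈ im(f) to h(x)) is a partial homomorphism, is a back and forth system. -/

import Mathlib

open Set

variable {A : Type*} {ι : Type*}

/-- `f` is a homomorphism (endomorphism) of the relational structure `(A, rel)`. -/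
def IsHom (ar : ι → ℕ) (rel : ∀ i, (Fin (ar i) → A) → Prop) (f : A → A) : Prop :=
  ∀ (i : ι) (x : Fin (ar i) → A), rel i x → rel i (f ∘ x)

/-- `f` is a self-embedding of the relational structure `(A, rel)`. -/
def IsEmb (ar : ι → ℕ) (rel : ∀ i, (Fin (ar i) → A) → Prop) (f : A → A) : Prop :=
  Function.Injective f ∧ ∀ (i : ι) (x : Fin (ar i) → A), (rel i x ↔ rel i (f ∘ x))

/-- `f` is an automorphism of the relational structure `(A, rel)`. -/
def IsAuto (ar : ι → ℕ) (rel : ∀ i, (Fin (ar i) → A) → Prop) (f : A → A) : Prop :=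
  Function.Bijective f ∧ ∀ (i : ι) (x : Fin (ar i) → A), (rel i x ↔ rel i (f ∘ x))

/-- `p` is an isomorphism between induced substructures when restricted to `D`. -/
def IsPartialIsoOn (ar : ι → ℕ) (rel : ∀ i, (Fin (ar i) → A) → Prop)
    (D : Set A) (p : A → A) : Prop :=
  Set.InjOn p D ∧
    ∀ (i : ι) (x : Fin (ar i) → A), (∀ k, x k ∈ D) → (rel i x ↔ rel i (p ∘ x))

/-- `p` is a homomorphism between induced substructures when restricted to `D`. -/
def IsPartialHomOn (ar : ι → ℕ) (rel : ∀ i, (Fin (ar i) → A) → Prop)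
    (D : Set A) (p : A → A) : Prop :=
  ∀ (i : ι) (x : Fin (ar i) → A), (∀ k, x k ∈ D) → rel i x → rel i (p ∘ x)

/-- Every isomorphism between finite induced substructures extends to an automorphism. -/
def Homogeneous (ar : ι → ℕ) (rel : ∀ i, (Fin (ar i) → A) → Prop) : Prop :=
  ∀ (D : Finset A) (p : A → A), IsPartialIsoOn ar rel ↑D p →
    ∃ g : A → A, IsAuto ar rel g ∧ ∀ a ∈ D, g a = p a

/-- Every orbit on `A \ F` of the pointwise stabiliser of a finite set `F` is infinite. -/
def NoAlgebraicity (ar : ι → ℕ) (rel : ∀ i, (Fin (ar i) → A) → Prop) : Prop :=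
  ∀ (F : Finset A) (a : A), a ∉ F →
    {b : A | ∃ g : A → A, IsAuto ar rel g ∧ (∀ x ∈ F, g x = x) ∧ g a = b}.Infinite

/-- For every `k`, the action of the automorphism group on `k`-tuples has
finitely many orbits. -/
def OmegaCategorical (ar : ι → ℕ) (rel : ∀ i, (Fin (ar i) → A) → Prop) : Prop :=
  ∀ k : ℕ,
    (Set.range fun v : Fin k → A =>
      {w : Fin k → A | ∃ g : A → A, IsAuto ar rel g ∧ w = g ∘ v}).Finite

/-- The endomorphisms of `(A, rel)`, as a set of functions. -/
def endSet (ar : ι → ℕ) (rel : ∀ i, (Fin (ar i) → A) → Prop) : Set (A → A) :=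
  {f : A → A | IsHom ar rel f}

/-- The self-embeddings of `(A, rel)`, as a set of functions. -/
def embSet (ar : ι → ℕ) (rel : ∀ i, (Fin (ar i) → A) → Prop) : Set (A → A) :=
  {f : A → A | IsEmb ar rel f}

/-- The automorphisms of `(A, rel)`, as a set of functions. -/
def autSet (ar : ι → ℕ) (rel : ∀ i, (Fin (ar i) → A) → Prop) : Set (A → A) :=
  {f : A → A | IsAuto ar rel f}

/-- `(A, rel)` is arsfacere, witnessed by the relation symbol `E`. -/
def ArsfacereWith (ar : ι → ℕ) (rel : ∀ i, (Fin (ar i) → A) → Prop) (E : ι) : Prop :=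
  (∀ x : A, ¬ rel E (fun _ => x)) ∧
  ∀ (x : A) (F : Fin (ar E) → Finset A),
    (∀ i j : Fin (ar E), i ≠ j → ((F i : Set A) ∩ (F j : Set A)) = {x}) →
    ∃ f : A → A,
      Set.InjOn f (⋃ i, (F i : Set A)) ∧
      (∀ i, IsPartialIsoOn ar rel (F i : Set A) f) ∧
      ∀ y : Fin (ar E) → A, (∀ k, y k ∈ F k ∧ y k ≠ x) →
        ∃ σ : Equiv.Perm (Fin (ar E)), rel E (fun k => f (y (σ k)))

open Classical in
/-- The endomorphism `g` is **rth**: it is surjective, and whenever the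
extension of `g|_U` by `u ↦ v` (for `u ∉ U` finite) is a homomorphism between
induced substructures, there is an automorphism fixing `U` pointwise taking
`u` to a `g`-preimage of `v`. -/
def IsRth (ar : ι → ℕ) (rel : ∀ i, (Fin (ar i) → A) → Prop) (g : A → A) : Prop :=
  Function.Surjective g ∧
    ∀ (U : Finset A) (u : A), u ∉ U → ∀ v : A,
      IsPartialHomOn ar rel (↑U ∪ {u}) (fun x => if _h : x = u then v else g x) →
      ∃ α : A → A, IsAuto ar rel α ∧ (∀ x ∈ U, α x = x) ∧ g (α u) = v

/-- The endomorphism `f` is **fo**: it is a self-embedding, and for every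
finite `Y ⊆ A ∖ im(f)` there is a finite `W ⊆ im(f)` such that every map which
is a homomorphism on `im(f)` and on `Y ∪ W` is a homomorphism on
`im(f) ∪ Y`. -/
def IsFo (ar : ι → ℕ) (rel : ∀ i, (Fin (ar i) → A) → Prop) (f : A → A) : Prop :=
  IsEmb ar rel f ∧
    ∀ Y : Finset A, (↑Y : Set A) ⊆ (Set.range f)ᶜ →
      ∃ W : Finset A, (↑W : Set A) ⊆ Set.range f ∧
        ∀ t : A → A,
          IsPartialHomOn ar rel (Set.range f) t →
          IsPartialHomOn ar rel (↑Y ∪ ↑W) t →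
          IsPartialHomOn ar rel (Set.range f ∪ ↑Y) t

/-- The self-embedding `f` is **back**: for every finite `T` there is a finite
`U ⊇ T` such that for every `v ∉ U` there is an automorphism `α` fixing `U`
pointwise with `α v ∉ im(f)`, and such that every finite partial map `t` with
`α '' (U ∪ {v}) ⊆ dom t ⊆ α '' (U ∪ {v}) ∪ im(f)` which is a homomorphism on
`dom t ∖ {α v}` and on `α '' (U ∪ {v})` is a homomorphism on `dom t`. -/
def IsBack (ar : ι → ℕ) (rel : ∀ i, (Fin (ar i) → A) → Prop) (f : A → A) : Prop :=
  ∀ T : Finset A, ∃ U : Finset A, T ⊆ U ∧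
    ∀ v : A, v ∉ U →
      ∃ α : A → A, IsAuto ar rel α ∧ (∀ x ∈ U, α x = x) ∧
        α v ∉ Set.range f ∧
        ∀ D : Set A, D.Finite →
          α '' (↑U ∪ {v}) ⊆ D → D ⊆ α '' (↑U ∪ {v}) ∪ Set.range f →
          ∀ t : A → A,
            IsPartialHomOn ar rel (D \ {α v}) t →
            IsPartialHomOn ar rel (α '' (↑U ∪ {v})) t →
            IsPartialHomOn ar rel D t

/-- Membership of the finite partial isomorphism `p` (with domain `D`) in the
set `S_{f,g,h}`: `p` is a partial isomorphism, the composite `f p g` is a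
restriction of `h`, and the partial map `p g ∪ f⁻¹ h` (defined on
`D ∪ im(f)`, sending `y ∈ D` to `g (p y)` and `f z` to `h z`) is a partial
homomorphism. -/
def MemS (ar : ι → ℕ) (rel : ∀ i, (Fin (ar i) → A) → Prop)
    (f g h : A → A) (D : Finset A) (p : A → A) : Prop :=
  IsPartialIsoOn ar rel ↑D p ∧
  (∀ x : A, f x ∈ D → g (p (f x)) = h x) ∧
  (∀ (i : ι) (x : Fin (ar i) → A), (∀ k, x k ∈ ↑D ∪ Set.range f) → rel i x →
    ∀ w : Fin (ar i) → A,
      (∀ k, (x k ∈ D ∧ w k = g (p (x k))) ∨ (∃ z : A, f z = x k ∧ w k = h z)) →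
      rel i w)

section BackAndForth

variable {ar : ι → ℕ} {rel : ∀ i, (Fin (ar i) → A) → Prop} {f g h : A → A}

theorem IsAuto.comp {α β : A → A} (hα : IsAuto ar rel α) (hβ : IsAuto ar rel β) :
    IsAuto ar rel (α ∘ β) :=
  ⟨hα.1.comp hβ.1, fun i x => (hβ.2 i x).trans (hα.2 i (β ∘ x))⟩

theorem IsAuto.exists_inverse {α : A → A} (hα : IsAuto ar rel α) :
    ∃ γ : A → A, IsAuto ar rel γ ∧ (∀ x, γ (α x) = x) ∧ ∀ x, α (γ x) = x := by
  obtain ⟨γ, hl, hr⟩ := Function.bijective_iff_has_inverse.1 hα.1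
  refine ⟨γ, ⟨Function.bijective_iff_has_inverse.2 ⟨α, hr, hl⟩, fun i x => ?_⟩, hl, hr⟩
  have hx : α ∘ γ ∘ x = x := funext fun k => hr (x k)
  rw [hα.2 i (γ ∘ x), hx]

theorem IsAuto.isPartialIsoOn {α : A → A} (hα : IsAuto ar rel α) (D : Set A) :
    IsPartialIsoOn ar rel D α :=
  ⟨hα.1.1.injOn, fun i x _ => hα.2 i x⟩

theorem IsPartialIsoOn.mono {D E : Set A} {p : A → A} (hp : IsPartialIsoOn ar rel E p)
    (hDE : D ⊆ E) : IsPartialIsoOn ar rel D p :=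
  ⟨hp.1.mono hDE, fun i x hx => hp.2 i x fun k => hDE (hx k)⟩

theorem IsPartialHomOn.mono {D E : Set A} {t : A → A} (ht : IsPartialHomOn ar rel E t)
    (hDE : D ⊆ E) : IsPartialHomOn ar rel D t :=
  fun i x hx => ht i x fun k => hDE (hx k)

theorem IsPartialHomOn.congr {D : Set A} {s t : A → A} (hs : IsPartialHomOn ar rel D s)
    (hst : ∀ x ∈ D, t x = s x) : IsPartialHomOn ar rel D t := by
  intro i x hx hrel
  have : t ∘ x = s ∘ x := funext fun k => hst _ (hx k)
  exact this ▸ hs i x hx hrel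

theorem IsHom.comp_isAuto {α : A → A} (hg : IsHom ar rel g) (hα : IsAuto ar rel α)
    (D : Set A) : IsPartialHomOn ar rel D (g ∘ α) :=
  fun i x _ hx => hg i (α ∘ x) ((hα.2 i x).1 hx)

/-- A map `t` with `t ∘ f = h` restricts to a homomorphism on `range f`. -/
theorem IsEmb.isPartialHomOn_range {t : A → A} (hf : IsEmb ar rel f) (hh : IsHom ar rel h)
    (ht : ∀ z, t (f z) = h z) : IsPartialHomOn ar rel (Set.range f) t := by
  intro i x hx hrel
  choose z hz using hx
  obtain rfl : f ∘ z = x := funext hz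
  have : t ∘ f ∘ z = h ∘ z := funext fun k => ht (z k)
  exact this ▸ hh i z ((hf.2 i z).2 hrel)

theorem memS_of_isPartialHomOn {D : Finset A} {p t : A → A} (hp : IsPartialIsoOn ar rel ↑D p)
    (hf : ∀ z, t (f z) = h z) (hD : ∀ x ∈ D, t x = g (p x))
    (ht : IsPartialHomOn ar rel (↑D ∪ Set.range f) t) : MemS ar rel f g h D p := by
  refine ⟨hp, fun x hx => by rw [← hD _ hx, hf], fun i x hx hrel w hw => ?_⟩
  obtain rfl : w = t ∘ x := by
    funext k
    rcases hw k with ⟨hk, e⟩ | ⟨z, hz, e⟩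
    · rw [e, Function.comp_apply, hD _ hk]
    · rw [e, Function.comp_apply, ← hz, hf]
  exact ht i x hx hrel

open Classical in
theorem MemS.exists_isPartialHomOn (hf : Function.Injective f) {D : Finset A} {p : A → A}
    (hp : MemS ar rel f g h D p) :
    ∃ t : A → A, (∀ z, t (f z) = h z) ∧ (∀ x ∈ D, t x = g (p x)) ∧
      IsPartialHomOn ar rel (↑D ∪ Set.range f) t := by
  obtain ⟨-, hfp, hhom⟩ := hp
  have ht : ∀ z, (if f z ∈ D then g (p (f z)) else Function.extend f h id (f z)) = h z := by
    intro z
    split_ifs with hz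
    · exact hfp z hz
    · exact hf.extend_apply h id z
  refine ⟨fun x => if x ∈ D then g (p x) else Function.extend f h id x, ht,
    fun x hx => if_pos hx, fun i x hx hrel => hhom i x hx hrel _ fun k => ?_⟩
  rcases hx k with hk | ⟨z, hz⟩
  · exact .inl ⟨hk, if_pos hk⟩
  · exact .inr ⟨z, hz, by rw [Function.comp_apply, ← hz]; exact ht z⟩

theorem MemS.mono (hf : Function.Injective f) {D E : Finset A} {p : A → A}
    (hp : MemS ar rel f g h E p) (hDE : D ⊆ E) : MemS ar rel f g h D p := by
  obtain ⟨t, h1, h2, h3⟩ := hp.exists_isPartialHomOn hf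
  exact memS_of_isPartialHomOn (hp.1.mono (Finset.coe_subset.2 hDE)) h1
    (fun x hx => h2 x (hDE hx))
    (h3.mono (Set.union_subset_union_left _ (Finset.coe_subset.2 hDE)))

open Classical in
/-- One-point extensions by points of `R` iterate to extensions by finite subsets of `R`. -/
theorem MemS.exists_union_of_exists_insert {R : Set A}
    (step : ∀ (D : Finset A) (p : A → A), MemS ar rel f g h D p → ∀ a ∈ R,
      ∃ p', MemS ar rel f g h (insert a D) p' ∧ ∀ x ∈ D, p' x = p x)
    {D : Finset A} {p : A → A} (hp : MemS ar rel f g h D p) (E : Finset A) (hE : ↑E ⊆ R) :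
    ∃ p', MemS ar rel f g h (D ∪ E) p' ∧ ∀ x ∈ D, p' x = p x := by
  induction E using Finset.induction_on with
  | empty => exact ⟨p, by rwa [Finset.union_empty], fun _ _ => rfl⟩
  | insert a E _ ih =>
    rw [Finset.coe_insert, Set.insert_subset_iff] at hE
    obtain ⟨q, hq, hqp⟩ := ih hE.2
    obtain ⟨r, hr, hrq⟩ := step _ q hq a hE.1
    exact ⟨r, by rwa [Finset.union_insert],
      fun x hx => (hrq x (Finset.mem_union_left _ hx)).trans (hqp x hx)⟩

open Classical in
theorem MemS.exists_insert_of_mem_range (homog : Homogeneous ar rel)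
    (hf : Function.Injective f) (hrth : IsRth ar rel g) {D : Finset A} {p : A → A}
    (hp : MemS ar rel f g h D p) {a : A} (ha : a ∈ Set.range f) :
    ∃ p', MemS ar rel f g h (insert a D) p' ∧ ∀ x ∈ D, p' x = p x := by
  by_cases haD : a ∈ D
  · exact ⟨p, by rwa [Finset.insert_eq_of_mem haD], fun _ _ => rfl⟩
  obtain ⟨t, htf, htD, ht⟩ := hp.exists_isPartialHomOn hf
  obtain ⟨β, hβ, hβp⟩ := homog D p hp.1
  obtain ⟨γ, hγ, hγβ, -⟩ := hβ.exists_inverse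
  have hβa : β a ∉ D.image β := by
    intro hmem
    obtain ⟨x, hx, e⟩ := Finset.mem_image.1 hmem
    exact haD (hβ.1.1 e ▸ hx)
  have hhom : IsPartialHomOn ar rel (↑(D.image β) ∪ {β a})
      (fun x => if _h : x = β a then t a else g x) := by
    have hγD : ∀ y ∈ (↑(D.image β) ∪ {β a} : Set A), γ y ∈ (↑D ∪ Set.range f : Set A) := by
      rintro y (hy | rfl)
      · obtain ⟨x, hx, rfl⟩ := Finset.mem_image.1 (Finset.mem_coe.1 hy)
        rw [hγβ]
        exact .inl hx
      · rw [hγβ]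
        exact .inr ha
    have htγ : IsPartialHomOn ar rel (↑(D.image β) ∪ {β a}) (t ∘ γ) := fun i x hx hrel =>
      ht i (γ ∘ x) (fun k => hγD _ (hx k)) ((hγ.2 i x).1 hrel)
    refine htγ.congr fun y hy => ?_
    split_ifs with hya
    · rw [hya, Function.comp_apply, hγβ]
    · obtain ⟨x, hx, rfl⟩ := Finset.mem_image.1 (Finset.mem_coe.1 (hy.resolve_right hya))
      rw [Function.comp_apply, hγβ, htD x hx, hβp x hx]
  obtain ⟨α, hα, hαfix, hαa⟩ := hrth.2 (D.image β) (β a) hβa (t a) hhom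
  have hext : ∀ x ∈ D, (α ∘ β) x = p x := fun x hx =>
    (hαfix _ (Finset.mem_image_of_mem β hx)).trans (hβp x hx)
  refine ⟨α ∘ β, memS_of_isPartialHomOn ((hα.comp hβ).isPartialIsoOn _) htf ?_ ?_, hext⟩
  · intro x hx
    rcases Finset.mem_insert.1 hx with rfl | hx
    · exact hαa.symm
    · rw [hext x hx, htD x hx]
  · refine ht.mono ?_
    rw [Finset.coe_insert]
    exact Set.union_subset (Set.insert_subset (.inr ha) Set.subset_union_left)
      Set.subset_union_right

open Classical in
theorem MemS.exists_insert (homog : Homogeneous ar rel) (hg : IsHom ar rel g)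
    (hfo : IsFo ar rel f) (hrth : IsRth ar rel g) (hh : IsHom ar rel h)
    {D : Finset A} {p : A → A} (hp : MemS ar rel f g h D p) (a : A) :
    ∃ p', MemS ar rel f g h (insert a D) p' ∧ ∀ x ∈ D, p' x = p x := by
  by_cases haf : a ∈ Set.range f
  · exact hp.exists_insert_of_mem_range homog hfo.1.1 hrth haf
  obtain ⟨W, hW, hWhom⟩ := hfo.2 ((insert a D).filter (· ∉ Set.range f))
    fun x hx => (Finset.mem_filter.1 (Finset.mem_coe.1 hx)).2
  obtain ⟨q, hq, hqp⟩ := hp.exists_union_of_exists_insert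
    (fun _ _ hp _ ha => hp.exists_insert_of_mem_range homog hfo.1.1 hrth ha) W hW
  obtain ⟨t, htf, htD, -⟩ := hq.exists_isPartialHomOn hfo.1.1
  obtain ⟨β, hβ, hβq⟩ := homog _ q hq.1
  let s : A → A := fun x => if x ∈ Set.range f then t x else g (β x)
  have hsf : ∀ z, s (f z) = h z := fun z => (if_pos (Set.mem_range_self z)).trans (htf z)
  have hsβ : ∀ x ∈ insert a (D ∪ W), s x = g (β x) := by
    intro x hx
    by_cases hxf : x ∈ Set.range f
    · have hxD : x ∈ D ∪ W :=
        (Finset.mem_insert.1 hx).resolve_left fun e => haf (e ▸ hxf)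
      exact (if_pos hxf).trans (by rw [htD x hxD, hβq x hxD])
    · exact if_neg hxf
  have hshom := hWhom s (hfo.1.isPartialHomOn_range hh hsf) <|
    (hg.comp_isAuto hβ _).congr fun x hx => hsβ x <| by
      rcases hx with hx | hx
      · exact Finset.insert_subset_insert a Finset.subset_union_left
          (Finset.mem_filter.1 (Finset.mem_coe.1 hx)).1
      · exact Finset.mem_insert_of_mem (Finset.mem_union_right _ hx)
  refine ⟨β, memS_of_isPartialHomOn (hβ.isPartialIsoOn _) hsf
    (fun x hx => hsβ x (Finset.insert_subset_insert a Finset.subset_union_left hx))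
    (hshom.mono ?_), fun x hx => ?_⟩
  · rintro x (hx | hx)
    · by_cases hxf : x ∈ Set.range f
      · exact .inl hxf
      · exact .inr (Finset.mem_coe.2 (Finset.mem_filter.2 ⟨hx, hxf⟩))
    · exact .inl hx
  · rw [hβq x (Finset.mem_union_left _ hx), hqp x hx]

open Classical in
theorem MemS.exists_mem_image (homog : Homogeneous ar rel) (hg : IsHom ar rel g)
    (hback : IsBack ar rel f) (hfo : IsFo ar rel f) (hrth : IsRth ar rel g)
    (hh : IsHom ar rel h) {D : Finset A} {p : A → A} (hp : MemS ar rel f g h D p) (b : A) :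
    ∃ (D' : Finset A) (p' : A → A), MemS ar rel f g h D' p' ∧
      D ⊆ D' ∧ (∀ x ∈ D, p' x = p x) ∧ b ∈ p' '' ↑D' := by
  obtain ⟨U, hDU, hU⟩ := hback D
  obtain ⟨q, hq', hqp⟩ := hp.exists_union_of_exists_insert (R := Set.univ)
    (fun _ _ hp a _ => hp.exists_insert homog hg hfo hrth hh a) U (Set.subset_univ _)
  have hq : MemS ar rel f g h U q := hq'.mono hfo.1.1 Finset.subset_union_right
  by_cases hb : b ∈ q '' ↑U
  · exact ⟨U, q, hq, hDU, hqp, hb⟩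
  obtain ⟨t, htf, htU, ht⟩ := hq.exists_isPartialHomOn hfo.1.1
  obtain ⟨β, hβ, hβq⟩ := homog U q hq.1
  obtain ⟨v, rfl⟩ := hβ.1.2 b
  have hv : v ∉ U := fun hv => hb ⟨v, hv, (hβq v hv).symm⟩
  obtain ⟨α, hα, hαfix, hαv, hαhom⟩ := hU v hv
  obtain ⟨γ, hγ, hγα, -⟩ := hα.exists_inverse
  have hαU : α '' (↑U ∪ {v}) = ↑(insert (α v) U) := by
    rw [Set.image_union, Set.image_singleton, Set.union_singleton, Finset.coe_insert]
    congr 1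
    exact (Set.EqOn.image_eq fun x hx => hαfix x hx).trans (Set.image_id _)
  have hβγ : ∀ x ∈ U, (β ∘ γ) x = q x := fun x hx => by
    rw [Function.comp_apply, ← hβq x hx]
    conv_lhs => rw [← hαfix x hx, hγα]
  let s : A → A := fun x => if x = α v then g (β v) else t x
  have hst : ∀ x, x ≠ α v → s x = t x := fun x hx => if_neg hx
  have hsf : ∀ z, s (f z) = h z := fun z =>
    (hst _ fun e => hαv ⟨z, e⟩).trans (htf z)
  have hsβ : ∀ x ∈ insert (α v) U, s x = g ((β ∘ γ) x) := by
    intro x hx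
    by_cases hxv : x = α v
    · rw [hxv, Function.comp_apply, hγα]
      exact if_pos rfl
    · have hxU := (Finset.mem_insert.1 hx).resolve_left hxv
      rw [hst x hxv, htU x hxU, hβγ x hxU]
  have hshom : IsPartialHomOn ar rel (↑(insert (α v) U) ∪ Set.range f) s := by
    intro i x hx hrel
    refine hαhom (↑(insert (α v) U) ∪ Set.range x)
      ((Finset.finite_toSet _).union (Set.finite_range x)) ?_ ?_ s ?_ ?_ i x
      (fun k => .inr (Set.mem_range_self k)) hrel
    · rw [hαU]
      exact Set.subset_union_left
    · rw [hαU]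
      exact Set.union_subset Set.subset_union_left (Set.range_subset_iff.2 hx)
    · refine (ht.mono ?_).congr fun y hy => hst y hy.2
      have hmem : ∀ y ∈ (↑(insert (α v) U) ∪ Set.range f : Set A), y ≠ α v →
          y ∈ (↑U ∪ Set.range f : Set A) := fun y hy hyv =>
        hy.imp_left fun hy => (Finset.mem_insert.1 (Finset.mem_coe.1 hy)).resolve_left hyv
      rintro y ⟨hy | ⟨k, rfl⟩, hyv⟩
      · exact hmem y (.inl hy) hyv
      · exact hmem _ (hx k) hyv
    · rw [hαU]
      exact (hg.comp_isAuto (hβ.comp hγ) _).congr hsβ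
  refine ⟨insert (α v) U, β ∘ γ,
    memS_of_isPartialHomOn ((hβ.comp hγ).isPartialIsoOn _) hsf hsβ hshom,
    hDU.trans (Finset.subset_insert _ _), fun x hx => ?_, α v, ?_, ?_⟩
  · rw [hβγ x (hDU hx), hqp x hx]
  · exact Finset.mem_coe.2 (Finset.mem_insert_self _ _)
  · rw [Function.comp_apply, hγα]

end BackAndForth

theorem S_fgh_is_back_and_forth
    [Countable A]
    (ar : ι → ℕ) (rel : ∀ i, (Fin (ar i) → A) → Prop)
    (homog : Homogeneous ar rel)
    (f g : A → A) (hfEnd : IsHom ar rel f) (hgEnd : IsHom ar rel g)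
    (hback : IsBack ar rel f) (hfo : IsFo ar rel f) (hrth : IsRth ar rel g)
    (h : A → A) (hh : IsHom ar rel h) :
    ∀ (D : Finset A) (p : A → A), MemS ar rel f g h D p →
      (∀ a : A, a ∉ D →
        ∃ (D' : Finset A) (p' : A → A), MemS ar rel f g h D' p' ∧
          D ⊆ D' ∧ (∀ x ∈ D, p' x = p x) ∧ a ∈ D') ∧
      (∀ b : A, b ∉ p '' ↑D →
        ∃ (D' : Finset A) (p' : A → A), MemS ar rel f g h D' p' ∧
          D ⊆ D' ∧ (∀ x ∈ D, p' x = p x) ∧ b ∈ p' '' ↑D') := by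
  classical
  intro D p hp
  refine ⟨fun a _ => ?_, fun b _ =>
    hp.exists_mem_image homog hgEnd hback hfo hrth hh b⟩
  obtain ⟨q, hq, hqp⟩ := hp.exists_insert homog hgEnd hfo hrth hh a
  exact ⟨insert a D, q, hq, Finset.subset_insert a D, hqp, Finset.mem_insert_self a D⟩
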